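/- Let Φ be a reduced irreducible root system spanning V, with weight lattice P∨ in V∨ (i.e., the coweight lattice {μ ∈ V∨ : ⟨α, μ⟩ ∈ ℤ for all α ∈ Φ}). An element μ ∈ P∨ is quasi-constant if and only if there exist an integer m and an element μ₀ ∈ P∨ such that μ = m·μ₀ and μ₀ is either minuscule or cominuscule. -/

import Mathlib

namespace QC

open Classical

variable {V : Type*} [AddCommGroup V] [Module ℚ V]

/-- The contragredient action of a linear automorphism `w` of `V` on the dual space,
characterized by `⟨w x, coact w f⟩ = ⟨x, f⟩`, i.e. `(coact w f) x = f (w⁻¹ x)`. -/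
noncomputable def coact (w : V ≃ₗ[ℚ] V) (f : Module.Dual ℚ V) : Module.Dual ℚ V :=
  w.symm.dualMap f

/-- The Weyl group of the data `(Φ, co)`: the subgroup of linear automorphisms of `V`
generated by the reflections `s_α : x ↦ x - ⟨x, α∨⟩ α` for `α ∈ Φ`. -/
def weylGroup (Φ : Set V) (co : V → Module.Dual ℚ V) : Subgroup (V ≃ₗ[ℚ] V) :=
  Subgroup.closure { w : V ≃ₗ[ℚ] V | ∃ α ∈ Φ, ∀ x : V, w x = x - (co α x) • α }

/-- `χ ∈ V` is quasi-constant with respect to a group `G` of automorphisms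
(typically the Weyl group, or `W ⋊ Γ`). -/
def IsQuasiConstantWrt (Φ : Set V) (co : V → Module.Dual ℚ V)
    (G : Subgroup (V ≃ₗ[ℚ] V)) (χ : V) : Prop :=
  ∀ α ∈ Φ, co α χ ≠ 0 → ∀ σ, σ ∈ G → coact σ (co α) χ / co α χ ∈ ({-1, 0, 1} : Set ℚ)

/-- `χ ∈ V` is quasi-constant (with respect to the Weyl group). -/
def IsQuasiConstant (Φ : Set V) (co : V → Module.Dual ℚ V) (χ : V) : Prop :=
  IsQuasiConstantWrt Φ co (weylGroup Φ co) χ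

/-- A coweight `μ ∈ V∨` is quasi-constant with respect to a group `G`. -/
def IsQuasiConstantCowtWrt (Φ : Set V) (G : Subgroup (V ≃ₗ[ℚ] V))
    (μ : Module.Dual ℚ V) : Prop :=
  ∀ α ∈ Φ, μ α ≠ 0 → ∀ σ, σ ∈ G → μ (σ α) / μ α ∈ ({-1, 0, 1} : Set ℚ)

/-- A coweight `μ ∈ V∨` is quasi-constant (with respect to the Weyl group). -/
def IsQuasiConstantCowt (Φ : Set V) (co : V → Module.Dual ℚ V)
    (μ : Module.Dual ℚ V) : Prop :=
  IsQuasiConstantCowtWrt Φ (weylGroup Φ co) μ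

/-- `χ ∈ V` is minuscule: `⟨χ, α∨⟩ ∈ {-1,0,1}` for all roots `α`. -/
def IsMinuscule (Φ : Set V) (co : V → Module.Dual ℚ V) (χ : V) : Prop :=
  ∀ α ∈ Φ, co α χ ∈ ({-1, 0, 1} : Set ℚ)

/-- `μ ∈ V∨` is minuscule: `⟨α, μ⟩ ∈ {-1,0,1}` for all roots `α`. -/
def IsMinusculeCowt (Φ : Set V) (μ : Module.Dual ℚ V) : Prop :=
  ∀ α ∈ Φ, μ α ∈ ({-1, 0, 1} : Set ℚ)

/-- The weight lattice `P = {χ ∈ V : ⟨χ, β∨⟩ ∈ ℤ for all β ∈ Φ}`. -/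
def weightLattice (Φ : Set V) (co : V → Module.Dual ℚ V) : Set V :=
  { χ | ∀ β ∈ Φ, ∃ n : ℤ, co β χ = (n : ℚ) }

/-- The coweight lattice `P∨ = {μ ∈ V∨ : ⟨α, μ⟩ ∈ ℤ for all α ∈ Φ}`. -/
def coweightLattice (Φ : Set V) : Set (Module.Dual ℚ V) :=
  { μ | ∀ α ∈ Φ, ∃ n : ℤ, μ α = (n : ℚ) }

/-- `(Φ, co)` is a reduced root system (not necessarily spanning) in `V`, where
`co α` is the coroot `α∨` viewed as a linear functional, with the Weyl group acting
compatibly on roots and coroots. -/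
structure IsRootSystem (Φ : Set V) (co : V → Module.Dual ℚ V) : Prop where
  finite : Φ.Finite
  ne_zero : ∀ α ∈ Φ, α ≠ 0
  pair_self : ∀ α ∈ Φ, co α α = 2
  refl_mem : ∀ α ∈ Φ, ∀ β ∈ Φ, β - (co α β) • α ∈ Φ
  pair_int : ∀ α ∈ Φ, ∀ β ∈ Φ, ∃ n : ℤ, co α β = (n : ℚ)
  reduced : ∀ α ∈ Φ, ∀ c : ℚ, c • α ∈ Φ → c = 1 ∨ c = -1
  weyl_root : ∀ w, w ∈ weylGroup Φ co → ∀ α ∈ Φ, w α ∈ Φ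
  weyl_coroot : ∀ w, w ∈ weylGroup Φ co → ∀ α ∈ Φ, co (w α) = coact w (co α)

/-- `Φ` is irreducible: it is nonempty and admits no nontrivial orthogonal decomposition. -/
def IsIrreducible (Φ : Set V) (co : V → Module.Dual ℚ V) : Prop :=
  Φ.Nonempty ∧ ∀ Ψ ⊆ Φ, (∀ α ∈ Ψ, ∀ β ∈ Φ \ Ψ, co α β = 0) → Ψ = ∅ ∨ Ψ = Φ

/-- `Δ` is a base (set of simple roots) of `Φ`. -/
structure IsBase (Φ : Set V) (co : V → Module.Dual ℚ V) (Δ : Set V) : Prop where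
  subset : Δ ⊆ Φ
  indep : LinearIndependent ℚ ((↑) : Δ → V)
  span_eq : Submodule.span ℚ Δ = Submodule.span ℚ Φ
  decomp : ∀ α ∈ Φ, ∃ c : V →₀ ℕ, ↑c.support ⊆ Δ ∧
      (α = c.sum (fun v n => (n : ℚ) • v) ∨ α = - c.sum (fun v n => (n : ℚ) • v))

/-- `η` is the fundamental weight `η(α)` for the simple root `α ∈ Δ`:
`⟨η, β∨⟩ = δ_{αβ}` for `β ∈ Δ`. -/
def IsFundWeight (co : V → Module.Dual ℚ V) (Δ : Set V) (α : V) (η : V) : Prop :=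
  ∀ β ∈ Δ, co β η = if β = α then 1 else 0

/-- `f` is the fundamental coweight `η(α∨)` for the simple root `α ∈ Δ`:
`⟨β, f⟩ = δ_{αβ}` for `β ∈ Δ`. -/
def IsFundCoweight (Δ : Set V) (α : V) (f : Module.Dual ℚ V) : Prop :=
  ∀ β ∈ Δ, f β = if β = α then 1 else 0

/-- `χ` is cominuscule: `χ = η(α)` for some base `Δ` and `α ∈ Δ` such that the
fundamental coweight `η(α∨)` is minuscule. -/
def IsCominuscule (Φ : Set V) (co : V → Module.Dual ℚ V) (χ : V) : Prop :=
  χ ∈ Submodule.span ℚ Φ ∧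
  ∃ Δ : Set V, IsBase Φ co Δ ∧ ∃ α ∈ Δ, IsFundWeight co Δ α χ ∧
    ∀ f : Module.Dual ℚ V, IsFundCoweight Δ α f → IsMinusculeCowt Φ f

/-- `μ` is a cominuscule coweight: `μ = η(α∨)` for some base `Δ` and `α ∈ Δ` such that
the fundamental weight `η(α)` is minuscule. -/
def IsCominusculeCowt (Φ : Set V) (co : V → Module.Dual ℚ V)
    (μ : Module.Dual ℚ V) : Prop :=
  ∃ Δ : Set V, IsBase Φ co Δ ∧ ∃ α ∈ Δ, IsFundCoweight Δ α μ ∧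
    ∀ η : V, IsFundWeight co Δ α η → IsMinuscule Φ co η

/-- `χ` is `Δ`-dominant. -/
def IsDominant (co : V → Module.Dual ℚ V) (Δ : Set V) (χ : V) : Prop :=
  ∀ α ∈ Δ, 0 ≤ co α χ

/-- `μ ∈ V∨` is `Δ`-dominant. -/
def IsDominantCowt (Δ : Set V) (μ : Module.Dual ℚ V) : Prop :=
  ∀ α ∈ Δ, 0 ≤ μ α

/-- `χ` is orbitally `p`-close. -/
def IsOrbitallyPClose (Φ : Set V) (co : V → Module.Dual ℚ V) (p : ℕ) (χ : V) : Prop :=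
  ∀ α ∈ Φ, co α χ ≠ 0 → ∀ w, w ∈ weylGroup Φ co →
    |coact w (co α) χ / co α χ| ≤ (p : ℚ) - 1

end QC

namespace RootPairing

open Module Set

section Field

variable {ι K M N : Type*} [Field K] [AddCommGroup M] [Module K M]
  [AddCommGroup N] [Module K N] (P : RootPairing ι K M N)

/-- A nonzero functional does not vanish on a nonempty reflection-stable set of roots of an
irreducible root pairing. -/
lemma exists_mem_apply_root_ne_zero [NeZero (2 : K)] [P.IsIrreducible] {s : Set ι} (hs : s.Nonempty)
    (hs' : ∀ i, ∀ j ∈ s, P.reflectionPerm i j ∈ s) {f : Dual K M} (hf : f ≠ 0) :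
    ∃ i ∈ s, f (P.root i) ≠ 0 := by
  by_contra! h
  have htop : Submodule.span K (P.root '' s) = ⊤ := by
    apply IsIrreducible.eq_top_of_invtSubmodule_reflection (P := P)
    · intro i
      rw [End.mem_invtSubmodule, Submodule.span_le]
      rintro _ ⟨j, hj, rfl⟩
      exact Submodule.subset_span ⟨_, hs' i j hj, P.root_reflectionPerm i j⟩
    · obtain ⟨i, hi⟩ := hs
      rw [Submodule.ne_bot_iff]
      exact ⟨_, Submodule.subset_span (mem_image_of_mem _ hi), P.ne_zero i⟩
  refine hf (LinearMap.ext_on_range (v := fun i : s ↦ P.root i) ?_ fun i ↦ by simpa using h i i.2)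
  rw [← image_eq_range, htop]

lemma InvariantForm.two_mul_apply_root {P : RootPairing ι K M N} (B : P.InvariantForm)
    (x : M) (i : ι) :
    2 * B.form x (P.root i) = P.coroot' i x * B.form (P.root i) (P.root i) := by
  have := B.apply_reflection_reflection i x (P.root i)
  rw [reflection_apply, reflection_apply_self] at this
  simp only [map_neg, map_sub, map_smul, LinearMap.sub_apply, LinearMap.smul_apply,
    smul_eq_mul] at this
  linear_combination -this

lemma InvariantForm.apply_root_reflectionPerm {P : RootPairing ι K M N} (B : P.InvariantForm)
    (i j : ι) :
    B.form (P.root (P.reflectionPerm i j)) (P.root (P.reflectionPerm i j)) =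
      B.form (P.root j) (P.root j) := by
  simp [root_reflectionPerm]

end Field

namespace Base

variable {ι R M N : Type*} [CommRing R] [IsDomain R] [CharZero R] [AddCommGroup M] [Module R M]
  [AddCommGroup N] [Module R N] {P : RootPairing ι R M N}

/-- Some root has all its coefficients positive with respect to a given base. -/
lemma exists_root_eq_sum_forall_pos [Finite ι] [Nonempty ι] [P.IsCrystallographic] [P.IsReduced]
    [P.IsIrreducible] (b : P.Base) :
    ∃ (k : ι) (f : ι → ℤ), P.root k = ∑ j ∈ b.support, f j • P.root j ∧
      ∀ j ∈ b.support, 0 < f j := by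
  obtain ⟨k, hk⟩ := Finite.exists_max b.height
  have hk_nonneg (i) (hi : i ∈ b.support) : 0 ≤ P.pairingIn ℤ k i := by
    by_contra! h
    have hne : P.root k ≠ -P.root i := by
      intro hki
      have h1 := hk i
      have h2 : b.height k = -b.height i := by
        rw [← b.height_reflectionPerm_self i]
        congr 1
        exact P.root.injective (by simp [hki])
      rw [b.height_one_of_mem_support hi] at h2
      rw [b.height_one_of_mem_support hi] at h1
      lia
    obtain ⟨l, hl⟩ := P.root_add_root_mem_of_pairingIn_neg h hne
    have := b.height_add hl
    have := hk l
    have := b.height_one_of_mem_support hi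
    lia
  obtain ⟨f, hfs, hf, hkf⟩ := b.exists_root_eq_sum_int k
  have hf₀ : 0 < f := by
    refine hf.resolve_right fun hneg ↦ ?_
    obtain ⟨i, hi⟩ := b.support_nonempty
    have h1 := hk i
    rw [b.height_one_of_mem_support hi, Base.height_eq_sum hkf] at h1
    have := Finset.sum_nonpos fun i (_ : i ∈ b.support) ↦ hneg.le i
    lia
  refine ⟨k, f, hkf, ?_⟩
  obtain ⟨i₀, hi₀⟩ : ∃ i, 0 < f i := (Pi.lt_def.mp hf₀).2
  have hi₀s : i₀ ∈ b.support := hfs hi₀.ne'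
  have step (i j : b.support) (hi : 0 < f i) (hij : b.cartanMatrix j i ≠ 0) : 0 < f j := by
    refine (hf₀.le j).lt_of_ne' fun hj ↦ hij ?_
    have hsum : P.pairingIn ℤ k j = ∑ l ∈ b.support, f l * P.pairingIn ℤ l j := by
      apply FaithfulSMul.algebraMap_injective ℤ R
      rw [P.algebraMap_pairingIn, ← root_coroot'_eq_pairing, hkf]
      simp [← P.algebraMap_pairingIn ℤ]
    have hterm (l) (hl : l ∈ b.support) : f l * P.pairingIn ℤ l j ≤ 0 := by
      rcases eq_or_ne l j with rfl | hlj
      · simp [hj]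
      · exact mul_nonpos_of_nonneg_of_nonpos (hf₀.le l) (b.pairingIn_le_zero_of_ne hlj hl j.2)
    have h0 := (Finset.sum_eq_zero_iff_of_nonpos hterm).mp
      (le_antisymm (Finset.sum_nonpos hterm) (hsum ▸ hk_nonneg j j.2)) i i.2
    have h1 : P.pairingIn ℤ i j = 0 := by simpa [hi.ne'] using h0
    rw [cartanMatrix_apply_eq_zero_iff_symm]
    exact h1
  exact fun j hj ↦ b.induction_on_cartanMatrix (fun j ↦ 0 < f j) (i := ⟨i₀, hi₀s⟩) (j := ⟨j, hj⟩)
    hi₀ step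

end Base

section Rat

variable {ι M N : Type*} [AddCommGroup M] [Module ℚ M] [AddCommGroup N] [Module ℚ N]
  {P : RootPairing ι ℚ M N}

lemma eq_or_eq_two_mul_of_apply_root_mem [Finite ι] [P.IsCrystallographic] [P.IsReduced]
    [P.IsIrreducible] (B : P.InvariantForm) {μ : Dual ℚ M} (hμ : μ ≠ 0) {c : ι → ℚ}
    (hc : ∀ i, 0 < c i) (hc' : ∀ i j, c (P.reflectionPerm i j) = c j)
    (hμc : ∀ i, μ (P.root i) = 0 ∨ μ (P.root i) = c i ∨ μ (P.root i) = -c i) (i j : ι) :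
    c i = c j ∨
      (B.form (P.root j) (P.root j) = 2 * B.form (P.root i) (P.root i) ∧ c j = 2 * c i) ∨
      (B.form (P.root i) (P.root i) = 2 * B.form (P.root j) (P.root j) ∧ c i = 2 * c j) := by
  set n : ι → ℚ := fun i ↦ B.form (P.root i) (P.root i) with hn
  have hn' (i j) : n (P.reflectionPerm i j) = n j := B.apply_root_reflectionPerm i j
  obtain ⟨b, ⟨hcb, hnb⟩, hb⟩ : ∃ b ∈ {b | c b = c j ∧ n b = n j}, 0 < μ (P.root b) := by
    obtain ⟨b, ⟨hcb, hnb⟩, hb⟩ := P.exists_mem_apply_root_ne_zero (s := {b | c b = c j ∧ n b = n j})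
      ⟨j, rfl, rfl⟩ (fun i k hk ↦ by simpa only [mem_ofPred_eq, hc', hn'] using hk) hμ
    rcases hb.lt_or_gt with h | h
    · refine ⟨P.reflectionPerm b b, ⟨by rw [hc', hcb], by rw [hn', hnb]⟩, ?_⟩
      simpa [root_reflectionPerm] using h
    · exact ⟨b, ⟨hcb, hnb⟩, h⟩
  have hb' : μ (P.root b) = c b := by
    have := hμc b
    grind
  obtain ⟨k, ⟨hck, hnk⟩, hk⟩ : ∃ k ∈ {k | c k = c i ∧ n k = n i}, P.pairing k b < 0 := by
    obtain ⟨k, ⟨hck, hnk⟩, hk⟩ := P.exists_mem_apply_root_ne_zero (s := {k | c k = c i ∧ n k = n i})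
      (f := P.coroot' b)
      ⟨i, rfl, rfl⟩ (fun i k hk ↦ by simpa only [mem_ofPred_eq, hc', hn'] using hk)
      (fun h ↦ by simpa using LinearMap.congr_fun h (P.root b))
    rw [root_coroot'_eq_pairing] at hk
    rcases hk.lt_or_gt with h | h
    · exact ⟨k, ⟨hck, hnk⟩, h⟩
    · refine ⟨P.reflectionPerm k k, ⟨by rw [hc', hck], by rw [hn', hnk]⟩, ?_⟩
      simpa using h
  change c i = c j ∨ (n j = 2 * n i ∧ c j = 2 * c i) ∨ (n i = 2 * n j ∧ c i = 2 * c j)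
  rw [← hcb, ← hck, ← hnb, ← hnk]
  have hμ_refl (i j : ι) :
      μ (P.root (P.reflectionPerm i j)) = μ (P.root j) - P.pairing j i * μ (P.root i) := by
    simp [root_reflectionPerm, reflection_apply]
  have hkb := hμc (P.reflectionPerm b k)
  have hbk := hμc (P.reflectionPerm k b)
  have hbkb := hμc (P.reflectionPerm b (P.reflectionPerm k b))
  have hk' := hμc k
  have hlen : P.pairing b k * n k = P.pairing k b * n b := B.pairing_mul_eq_pairing_mul_swap k b
  simp only [hc', hμ_refl] at hkb hbk hbkb
  have hb0 := hc b
  have hk0 := hc k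
  have hsub : P.pairing (P.reflectionPerm k b) b = 2 - P.pairing b k * P.pairing k b := by
    rw [← root_coroot'_eq_pairing, root_reflectionPerm, reflection_apply]
    simp
  rw [hsub] at hbkb
  have hpq : (P.pairing k b = -1 ∧ P.pairing b k = -1) ∨ (P.pairing k b = -2 ∧ P.pairing b k = -2) ∨
      (P.pairing k b = -1 ∧ P.pairing b k = -2) ∨ (P.pairing k b = -2 ∧ P.pairing b k = -1) ∨
      (P.pairing k b = -1 ∧ P.pairing b k = -3) ∨ (P.pairing k b = -3 ∧ P.pairing b k = -1) := by
    have := P.pairingIn_pairingIn_mem_set_of_isCrystal_of_isRed k b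
    simp only [mem_insert_iff, mem_singleton_iff, Prod.mk_zero_zero, Prod.mk_eq_zero,
      Prod.mk_one_one, Prod.mk_eq_one, Prod.mk.injEq] at this
    simp only [← P.algebraMap_pairingIn ℤ, algebraMap_int_eq, eq_intCast] at hk ⊢
    norm_cast at hk ⊢
    lia
  rcases hpq with ⟨h₁, h₂⟩ | ⟨h₁, h₂⟩ | ⟨h₁, h₂⟩ | ⟨h₁, h₂⟩ | ⟨h₁, h₂⟩ | ⟨h₁, h₂⟩
  · left
    rw [← hc' b k, ← hc' k b]
    congr 1
    apply P.root.injective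
    simp [root_reflectionPerm, reflection_apply, h₁, h₂, add_comm]
  · left
    rw [← hc' b b]
    congr 1
    apply P.root.injective
    simpa [root_reflectionPerm] using (P.pairing_neg_two_neg_two_iff k b).mp ⟨h₁, h₂⟩
  all_goals
    rw [h₁, h₂] at hlen hbkb
    rw [h₁] at hkb
    rw [h₂] at hbk
    grind

variable (P) in
/-- Every functional is dominant with respect to some base. -/
lemma exists_base_forall_nonneg [Finite ι] [P.IsRootSystem] [P.IsCrystallographic]
    [P.IsReduced] (μ : Dual ℚ M) :
    ∃ b : P.Base, ∀ i ∈ b.support, 0 ≤ μ (P.root i) := by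
  obtain ⟨g, hg⟩ : ∃ g : Dual ℚ M, ∀ i, g (P.root i) ≠ 0 :=
    exists_dual_forall_apply_ne_zero P.root <| by simp [P.ne_zero]
  obtain ⟨C, hC⟩ := (Set.finite_range fun i ↦ |g (P.root i)| / |μ (P.root i)|).bddAbove
  have hC₀ (i : ι) : 0 < C + 1 := by
    have : |g (P.root i)| / |μ (P.root i)| ≤ C := hC ⟨i, rfl⟩
    linarith [this.trans' (by positivity)]
  have hlt (i) (hi : μ (P.root i) ≠ 0) : |g (P.root i)| < |(C + 1) * μ (P.root i)| := by
    rw [abs_mul, abs_of_pos (hC₀ i), ← div_lt_iff₀ (abs_pos.mpr hi)]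
    exact (hC ⟨i, rfl⟩).trans_lt (lt_add_one C)
  set f : Dual ℚ M := (C + 1) • μ + g with hf
  have hf₀ (i) : f (P.root i) ≠ 0 := by
    rcases eq_or_ne (μ (P.root i)) 0 with h | h
    · simpa [hf, h] using hg i
    · have := hlt i h
      simp only [hf, LinearMap.add_apply, LinearMap.smul_apply, smul_eq_mul]
      grind
  let := P.indexNeg
  refine ⟨Base.mk' P (IsAddIndecomposable.baseOf P.root (f : M →+ ℚ))
    (P.linearIndepOn_root_baseOf f hf₀)
    (fun i ↦ IsAddIndecomposable.mem_or_neg_mem_closure_baseOf P.root (f : M →+ ℚ) i (hf₀ i)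
      (by simp)), fun i hi ↦ ?_⟩
  have hi' : 0 < f (P.root i) :=
    IsAddIndecomposable.baseOf_subset_pos P.root (f : M →+ ℚ) (by simpa [Base.mk'] using hi)
  by_contra! h
  have := hlt i h.ne
  simp only [hf, LinearMap.add_apply, LinearMap.smul_apply, smul_eq_mul] at hi'
  have := mul_neg_of_pos_of_neg (hC₀ i) h
  grind

lemma InvariantForm.exists_coroot'_mul_eq (B : P.InvariantForm) (hB : B.form.Nondegenerate)
    [FiniteDimensional ℚ M] (f : Dual ℚ M) :
    ∃ x : M, ∀ i, P.coroot' i x * B.form (P.root i) (P.root i) = f (P.root i) := by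
  refine ⟨(B.form.toDual hB).symm ((1 / 2 : ℚ) • f), fun i ↦ ?_⟩
  rw [← B.two_mul_apply_root, ← LinearMap.BilinForm.toDual_def (b := hB),
    LinearEquiv.apply_symm_apply]
  simp

lemma Base.exists_mem_support_apply_ne_zero [P.IsRootSystem] (b : P.Base) {f : Dual ℚ M}
    (hf : f ≠ 0) : ∃ i ∈ b.support, f (P.root i) ≠ 0 := by
  by_contra! h
  exact hf (b.toWeightBasis.ext fun i ↦ by simpa using h i i.2)

lemma Base.coroot'_eq_of_forall_mem_support (b : P.Base) {x y : M}
    (h : ∀ i ∈ b.support, P.coroot' i x = P.coroot' i y) (k : ι) :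
    P.coroot' k x = P.coroot' k y := by
  obtain ⟨f, -, -, hf⟩ := b.flip.exists_root_eq_sum_int k
  simp only [flip_root, Base.flip_support] at hf
  have aux (z : M) : P.coroot' k z = ∑ j ∈ b.support, f j • P.coroot' j z := by
    simp [hf]
  rw [aux, aux]
  exact Finset.sum_congr rfl fun j hj ↦ by rw [h j hj]

lemma exists_base_eq_or_eq_zero [Finite ι] [Nonempty ι] [P.IsCrystallographic] [P.IsReduced]
    [P.IsIrreducible] {μ : Dual ℚ M} (hμ : μ ≠ 0) {c : ι → ℚ} (hc : ∀ i, 0 < c i)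
    (hμc : ∀ i, μ (P.root i) = 0 ∨ μ (P.root i) = c i ∨ μ (P.root i) = -c i)
    {χ : M} (hχ : ∀ i, P.coroot' i χ = μ (P.root i) / c i) :
    ∃ b : P.Base, ∃ i ∈ b.support, μ (P.root i) = c i ∧
      ∀ j ∈ b.support, j ≠ i → μ (P.root j) = 0 := by
  obtain ⟨b, hb⟩ := P.exists_base_forall_nonneg μ
  obtain ⟨i, hi, hμi⟩ := b.exists_mem_support_apply_ne_zero hμ
  have hμi' : μ (P.root i) = c i := by
    have := hμc i
    have := hc i
    have := hb i hi
    grind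
  refine ⟨b, i, hi, hμi', fun j hj hji ↦ ?_⟩
  by_contra hμj
  have hμj' : μ (P.root j) = c j := by
    have := hμc j
    have := hc j
    have := hb j hj
    grind
  obtain ⟨k, f, hk, hf⟩ := b.flip.exists_root_eq_sum_forall_pos
  simp only [flip_root, Base.flip_support] at hk hf
  have hsum : P.coroot' k χ = ∑ l ∈ b.support, f l * P.coroot' l χ := by
    simp [hk]
  have hterm (l) (hl : l ∈ b.support) : 0 ≤ f l * P.coroot' l χ := by
    have := hb l hl
    have := hc l
    have : (0 : ℚ) < f l := mod_cast hf l hl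
    rw [hχ]
    positivity
  have hone (l) (hl : l ∈ b.support) (h : μ (P.root l) = c l) : 1 ≤ f l * P.coroot' l χ := by
    rw [hχ, h, div_self (hc l).ne', mul_one]
    exact_mod_cast hf l hl
  have hle : P.coroot' k χ ≤ 1 := by
    rw [hχ, div_le_one (hc k)]
    have := hμc k
    have := hc k
    grind
  have := Finset.add_le_sum hterm hi hj hji.symm
  have := hone i hi hμi'
  have := hone j hj hμj'
  linarith

lemma exists_forall_eq_abs_of_quasiConstant [P.IsIrreducible] {μ : Dual ℚ M} (hμ : μ ≠ 0)
    (h : ∀ i, μ (P.root i) ≠ 0 → ∀ w ∈ Subgroup.closure (range P.reflection),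
      μ (w (P.root i)) / μ (P.root i) ∈ ({-1, 0, 1} : Set ℚ)) :
    ∃ c : ι → ℚ, (∀ i, 0 < c i) ∧ (∀ i j, c (P.reflectionPerm i j) = c j) ∧
      (∀ i, μ (P.root i) = 0 ∨ μ (P.root i) = c i ∨ μ (P.root i) = -c i) ∧
      ∀ i, ∃ j, c i = |μ (P.root j)| := by
  have hrefl (k) : P.reflection k ∈ Subgroup.closure (range P.reflection) :=
    Subgroup.subset_closure ⟨k, rfl⟩
  have aux (i) : ∃ j, (∃ w ∈ Subgroup.closure (range P.reflection), w (P.root i) = P.root j) ∧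
      μ (P.root j) ≠ 0 :=
    P.exists_mem_apply_root_ne_zero (s := {j | ∃ w ∈ _, w (P.root i) = P.root j})
      ⟨i, 1, one_mem _, rfl⟩
      (fun k j ⟨w, hw, hij⟩ ↦ ⟨P.reflection k * w, mul_mem (hrefl k) hw, by
        simp [root_reflectionPerm, hij]⟩) hμ
  choose t ht hμt using aux
  choose w hw hwt using ht
  have abs_eq {i j} {w : M ≃ₗ[ℚ] M} (hw : w ∈ Subgroup.closure (range P.reflection))
      (hij : w (P.root i) = P.root j) (hi : μ (P.root i) ≠ 0) (hj : μ (P.root j) ≠ 0) :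
      |μ (P.root i)| = |μ (P.root j)| := by
    have := h i hi w hw
    rw [hij, mem_insert_iff, mem_insert_iff, mem_singleton_iff, div_eq_iff hi, div_eq_iff hi,
      div_eq_iff hi] at this
    rcases this with h | h | h <;> simp_all
  refine ⟨fun i ↦ |μ (P.root (t i))|, fun i ↦ abs_pos.mpr (hμt i), fun i j ↦ ?_, fun i ↦ ?_,
    fun i ↦ ⟨t i, rfl⟩⟩
  · refine (abs_eq (mul_mem (mul_mem (hw (P.reflectionPerm i j)) (hrefl i)) (inv_mem (hw j))) ?_
      (hμt j) (hμt _)).symm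
    rw [← hwt (P.reflectionPerm i j), ← hwt j]
    simp [root_reflectionPerm]
  · by_cases hi : μ (P.root i) = 0
    · exact .inl hi
    · right
      simp only [← abs_eq (hw i) (hwt i) hi (hμt i)]
      grind

/-- A nonzero integral functional which takes at most one nonzero absolute value on each Weyl orbit
of roots is either an integer multiple of a functional with values in `{-1, 0, 1}` on the roots, or
an integer multiple of a fundamental coweight whose associated fundamental weight is minuscule. -/
theorem exists_int_of_quasiConstant [DecidableEq ι] [Finite ι] [Nonempty ι] [P.IsCrystallographic]
    [P.IsReduced] [P.IsIrreducible] [FiniteDimensional ℚ M] {μ : Dual ℚ M} (hμ : μ ≠ 0)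
    (hint : ∀ i, ∃ z : ℤ, μ (P.root i) = z)
    (h : ∀ i, μ (P.root i) ≠ 0 → ∀ w ∈ Subgroup.closure (range P.reflection),
      μ (w (P.root i)) / μ (P.root i) ∈ ({-1, 0, 1} : Set ℚ)) :
    ∃ m : ℤ, m ≠ 0 ∧ ((∀ i, μ (P.root i) = 0 ∨ μ (P.root i) = m ∨ μ (P.root i) = -m) ∨
      ∃ b : P.Base, ∃ i ∈ b.support,
        (∀ j ∈ b.support, μ (P.root j) = if j = i then (m : ℚ) else 0) ∧
        ∃ χ : M, (∀ j ∈ b.support, P.coroot' j χ = if j = i then 1 else 0) ∧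
          ∀ j, P.coroot' j χ ∈ ({-1, 0, 1} : Set ℚ)) := by
  have := Fintype.ofFinite ι
  obtain ⟨c, hc, hc', hμc, habs⟩ := exists_forall_eq_abs_of_quasiConstant hμ h
  have hcint (i) : ∃ z : ℤ, c i = z := by
    obtain ⟨j, hj⟩ := habs i
    obtain ⟨z, hz⟩ := hint j
    exact ⟨|z|, by simp [hj, hz]⟩
  let B := P.toInvariantForm
  have hpair := eq_or_eq_two_mul_of_apply_root_mem B hμ hc hc' hμc
  by_cases hconst : ∀ i j, c i = c j
  · obtain ⟨i₀⟩ := ‹Nonempty ι›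
    obtain ⟨m, hm⟩ := hcint i₀
    refine ⟨m, ?_, .inl fun i ↦ ?_⟩
    · have := hc i₀
      rintro rfl
      simp_all
    · rw [← hm, ← hconst i i₀]
      exact hμc i
  obtain ⟨i₀, j₀, hB₀, hc₀⟩ : ∃ i j,
      B.form (P.root j) (P.root j) = 2 * B.form (P.root i) (P.root i) ∧ c j = 2 * c i := by
    push Not at hconst
    obtain ⟨i, j, hij⟩ := hconst
    rcases hpair i j with h | h | h
    · exact absurd h hij
    · exact ⟨i, j, h⟩
    · exact ⟨j, i, h⟩
  have hi₀ := hc i₀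
  have hk (k) : (c k = c i₀ ∨ c k = 2 * c i₀) ∧
      c k * B.form (P.root i₀) (P.root i₀) = c i₀ * B.form (P.root k) (P.root k) := by
    have := hpair k i₀
    have := hpair k j₀
    have := hc k
    grind
  obtain ⟨χ, hχ⟩ : ∃ χ : M, ∀ i, P.coroot' i χ = μ (P.root i) / c i := by
    obtain ⟨χ, hχ⟩ := B.exists_coroot'_mul_eq P.rootForm_nondegenerate
      ((B.form (P.root i₀) (P.root i₀) / c i₀) • μ)
    refine ⟨χ, fun i ↦ ?_⟩
    have h1 := hχ i
    have h2 := (hk i).2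
    have h3 := B.ne_zero i
    have h4 := hc i
    rw [LinearMap.smul_apply, smul_eq_mul, div_mul_eq_mul_div, eq_div_iff hi₀.ne'] at h1
    rw [eq_div_iff h4.ne']
    apply mul_right_cancel₀ (mul_ne_zero h3 hi₀.ne')
    linear_combination c i * h1 + μ (P.root i) * h2
  obtain ⟨b, i, hi, hμi, hμj⟩ := exists_base_eq_or_eq_zero hμ hc hμc hχ
  have hci : c i = c i₀ := by
    refine (hk i).1.resolve_right fun hci ↦ ?_
    obtain ⟨k, hck, hμk⟩ := P.exists_mem_apply_root_ne_zero (s := {k | c k = c i₀})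
      ⟨i₀, rfl⟩ (fun i j hj ↦ by simpa only [mem_ofPred_eq, hc'] using hj) hμ
    obtain ⟨f, -, -, hf⟩ := b.exists_root_eq_sum_int k
    have hsum : μ (P.root k) = f i * (2 * c i₀) := by
      rw [hf, map_sum, Finset.sum_eq_single_of_mem i hi fun j hj hji ↦ by simp [hμj j hj hji]]
      simp [hμi, hci]
    have hck : c k = c i₀ := hck
    rcases hμc k with h | h | h
    · exact hμk h
    · have : (f i * 2 : ℚ) = 1 := mul_right_cancel₀ hi₀.ne' (by linarith)
      norm_cast at this
      lia
    · have : (f i * 2 : ℚ) = -1 := mul_right_cancel₀ hi₀.ne' (by linarith)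
      norm_cast at this
      lia
  obtain ⟨m, hm⟩ := hcint i₀
  refine ⟨m, ?_, .inr ⟨b, i, hi, fun j hj ↦ ?_, χ, fun j hj ↦ ?_, fun j ↦ ?_⟩⟩
  · rintro rfl
    simp_all
  · split_ifs with hji
    · rw [hji, hμi, hci, hm]
    · exact hμj j hj hji
  · split_ifs with hji
    · rw [hji, hχ, hμi, div_self (hc i).ne']
    · rw [hχ, hμj j hj hji, zero_div]
  · rw [hχ]
    rcases hμc j with h | h | h <;> simp [h, (hc j).ne']

end Rat

end RootPairing

namespace QC

open Module Set

variable {V : Type*} [AddCommGroup V] [Module ℚ V] {Φ : Set V} {co : V → Dual ℚ V}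

namespace IsRootSystem

lemma injOn (hRS : IsRootSystem Φ co) : InjOn co Φ := by
  intro α hα β hβ h
  have : IsAddTorsionFree V := .of_module_rat _
  have hmaps {γ} (hγ : γ ∈ Φ) : MapsTo (preReflection γ (co γ)) Φ Φ :=
    fun δ hδ ↦ hRS.refl_mem γ hγ δ hδ
  exact eq_of_mapsTo_reflection_of_mem hRS.finite (hRS.pair_self α hα) (hRS.pair_self β hβ)
    (by rw [← h, hRS.pair_self α hα]) (by rw [h, hRS.pair_self β hβ]) (hmaps hα) (hmaps hβ) hβ

variable [FiniteDimensional ℚ V] (hRS : IsRootSystem Φ co) (hspan : Submodule.span ℚ Φ = ⊤)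

/-- The root pairing between `V` and its dual associated to a root system spanning `V`. -/
noncomputable def rootPairing : RootPairing Φ ℚ V (Dual ℚ V) :=
  have : Finite Φ := hRS.finite
  .mk'' (Dual.eval ℚ V) (.subtype _) ⟨fun α ↦ co α, hRS.injOn.injective⟩
    (fun α ↦ hRS.pair_self α α.2)
    (fun α ↦ by
      rintro _ ⟨β, rfl⟩
      exact ⟨⟨_, hRS.refl_mem α α.2 β β.2⟩, rfl⟩)
    (by simpa using hspan)

@[simp] lemma rootPairing_root (α : Φ) : (hRS.rootPairing hspan).root α = α := rfl

@[simp] lemma rootPairing_coroot' (α : Φ) : (hRS.rootPairing hspan).coroot' α = co α := rfl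

instance : (hRS.rootPairing hspan).IsCrystallographic :=
  ⟨fun α β ↦ (hRS.pair_int β β.2 α α.2).imp fun _ h ↦ h.symm⟩

lemma isRootSystem_rootPairing : (hRS.rootPairing hspan).IsRootSystem :=
  have : Finite Φ := hRS.finite
  RootPairing.isRootSystem_mk'' (hsp := by simpa using hspan) fun α β ↦
    (hRS.pair_int β β.2 α α.2).imp fun _ h ↦ h.symm

lemma isReduced_rootPairing : (hRS.rootPairing hspan).IsReduced where
  eq_or_eq_neg α β h := by
    simp only [rootPairing_root] at h ⊢
    rw [LinearIndependent.pair_iff' (hRS.ne_zero α α.2)] at h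
    push Not at h
    obtain ⟨c, hc⟩ := h
    rcases hRS.reduced α α.2 c (hc ▸ β.2) with rfl | rfl
    · exact .inl (by simpa using hc)
    · exact .inr (by simp [← hc])

lemma isIrreducible_rootPairing (hirr : IsIrreducible Φ co) :
    (hRS.rootPairing hspan).IsIrreducible := by
  have : Finite Φ := hRS.finite
  have := hRS.isRootSystem_rootPairing hspan
  obtain ⟨⟨α₀, hα₀⟩, hirr⟩ := hirr
  have : Nontrivial V := ⟨α₀, 0, hRS.ne_zero α₀ hα₀⟩
  refine .mk' _ fun q hq hq₀ ↦ RootPairing.eq_top_of_mem_invtSubmodule_of_forall_eq_univ _ q hq₀ hq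
    fun Ψ ⟨α₁, hα₁⟩ hΨq hq' ↦ ?_
  have := hirr (Subtype.val '' Ψ) (by simp) fun α hα β hβ ↦ by
    obtain ⟨α, hα, rfl⟩ := hα
    have hβ' : (⟨β, hβ.1⟩ : Φ) ∉ Ψ := fun h ↦ hβ.2 ⟨_, h, rfl⟩
    have h0 : (hRS.rootPairing hspan).pairing α ⟨β, hβ.1⟩ = 0 :=
      hq' _ hβ' (hΨq ⟨α, hα, rfl⟩)
    exact (hRS.rootPairing hspan).pairing_eq_zero_iff.mp h0
  rcases this with h | h
  · simp_all
  · exact eq_univ_of_forall fun α ↦ by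
      obtain ⟨β, hβ, h⟩ := h.ge α.2
      rwa [← Subtype.ext h]

lemma weylGroup_eq_closure_range_reflection :
    weylGroup Φ co = Subgroup.closure (range (hRS.rootPairing hspan).reflection) := by
  rw [weylGroup]
  congr 1
  ext w
  constructor
  · rintro ⟨α, hα, h⟩
    exact ⟨⟨α, hα⟩, by ext x; simp [RootPairing.reflection_apply, h]⟩
  · rintro ⟨α, rfl⟩
    exact ⟨α, α.2, fun x ↦ by simp [RootPairing.reflection_apply]⟩

lemma isBase_image_support (b : (hRS.rootPairing hspan).Base) :
    IsBase Φ co (Subtype.val '' (b.support : Set Φ)) where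
  subset := by simp
  indep := b.linearIndepOn_root.id_image
  span_eq := by
    have h : Submodule.span ℚ (Subtype.val '' (b.support : Set Φ)) =
        Submodule.span ℚ (range Subtype.val) := b.span_root_support
    rwa [Subtype.range_coe] at h
  decomp α hα := by
    obtain ⟨f, -, hf⟩ := b.exists_root_eq_sum_nat_or_neg ⟨α, hα⟩
    refine ⟨∑ j ∈ b.support, .single (j : V) (f j), fun v hv ↦ ?_, ?_⟩
    · obtain ⟨j, hj, hv⟩ := Finsupp.mem_support_finsetSum v hv
      have := Finsupp.support_single_subset hv
      exact ⟨j, hj, by simp_all⟩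
    · rw [← Finsupp.sum_finsetSum_index (by simp) (by simp [add_smul])]
      simpa [Finsupp.sum_single_index, Nat.cast_smul_eq_nsmul] using hf

end IsRootSystem

lemma isQuasiConstantCowt_of_forall_apply_mem (hRS : IsRootSystem Φ co) {n : V → ℚ}
    (hn : ∀ w ∈ weylGroup Φ co, ∀ x, n (w x) = n x) {μ : Dual ℚ V}
    (hμ : ∀ α ∈ Φ, μ α = 0 ∨ μ α = n α ∨ μ α = -n α) :
    IsQuasiConstantCowt Φ co μ := by
  intro α hα hα₀ w hw
  have h1 := hμ α hα
  have h2 := hμ (w α) (hRS.weyl_root w hw α hα)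
  rw [hn w hw] at h2
  simp only [mem_insert_iff, mem_singleton_iff, div_eq_iff hα₀]
  grind

lemma IsQuasiConstantCowt.smul {μ : Dual ℚ V} (h : IsQuasiConstantCowt Φ co μ) (c : ℚ) :
    IsQuasiConstantCowt Φ co (c • μ) := by
  intro α hα hα₀ w hw
  simp only [LinearMap.smul_apply, smul_eq_mul, mul_ne_zero_iff] at hα₀ ⊢
  rw [mul_div_mul_left _ _ hα₀.1]
  exact h α hα hα₀.2 w hw

lemma IsMinusculeCowt.mem_coweightLattice {μ : Dual ℚ V} (h : IsMinusculeCowt Φ μ) :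
    μ ∈ coweightLattice Φ := by
  intro α hα
  rcases h α hα with h | h | h
  exacts [⟨-1, by simp [h]⟩, ⟨0, by simp [h]⟩, ⟨1, by simp_all⟩]

lemma IsMinusculeCowt.isQuasiConstantCowt (hRS : IsRootSystem Φ co) {μ : Dual ℚ V}
    (h : IsMinusculeCowt Φ μ) : IsQuasiConstantCowt Φ co μ :=
  isQuasiConstantCowt_of_forall_apply_mem hRS (n := 1) (by simp) fun α hα ↦ by
    have := h α hα
    simp only [mem_insert_iff, mem_singleton_iff] at this
    simp only [Pi.one_apply]
    tauto

lemma IsCominusculeCowt.isQuasiConstantCowt [FiniteDimensional ℚ V] (hRS : IsRootSystem Φ co)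
    (hspan : Submodule.span ℚ Φ = ⊤) {μ : Dual ℚ V} (h : IsCominusculeCowt Φ co μ) :
    IsQuasiConstantCowt Φ co μ := by
  obtain ⟨Δ, hΔ, α, hα, hμ, hη⟩ := h
  let P := hRS.rootPairing hspan
  have : Fintype Φ := hRS.finite.fintype
  have : P.IsRootSystem := hRS.isRootSystem_rootPairing hspan
  let B := P.toInvariantForm
  obtain ⟨x, hx⟩ := B.exists_coroot'_mul_eq P.rootForm_nondegenerate (B.form α α • μ)
  replace hx (β) (hβ : β ∈ Φ) : co β x * B.form β β = B.form α α * μ β := hx ⟨β, hβ⟩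
  have hne (β) (hβ : β ∈ Φ) : B.form β β ≠ 0 := B.ne_zero ⟨β, hβ⟩
  have hd := hne α (hΔ.subset hα)
  have hxΔ : IsFundWeight co Δ α x := fun β hβ ↦ by
    have h1 := hx β (hΔ.subset hβ)
    rw [hμ β hβ] at h1
    apply mul_right_cancel₀ (hne β (hΔ.subset hβ))
    rw [h1]
    split_ifs with h <;> simp [h]
  refine isQuasiConstantCowt_of_forall_apply_mem hRS (n := fun y ↦ B.form y y / B.form α α)
    (fun w hw y ↦ ?_) fun β hβ ↦ ?_
  · suffices B.form (w y) (w y) = B.form y y by rw [this]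
    rw [hRS.weylGroup_eq_closure_range_reflection hspan] at hw
    induction hw using Subgroup.closure_induction generalizing y with
    | mem w hw =>
      obtain ⟨i, rfl⟩ := hw
      exact B.apply_reflection_reflection i y y
    | one => rfl
    | mul v w _ _ hv hw => rw [LinearEquiv.mul_apply, hv, hw]
    | inv w _ hw => rw [← hw, ← LinearEquiv.mul_apply, mul_inv_cancel]; rfl
  · have h1 := hx β hβ
    have h2 := hη x hxΔ β hβ
    simp only [mem_insert_iff, mem_singleton_iff] at h2
    rw [← neg_div, eq_div_iff hd, eq_div_iff hd]
    rcases h2 with h2 | h2 | h2 <;> rw [h2] at h1 <;> grind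

end QC

/-- Theorem 1.4 of the paper, cocharacter case. Let `Φ` be a reduced
irreducible root system spanning `V`, with coweight lattice `P∨ ⊆ V∨`. An element
`μ ∈ P∨` is quasi-constant if and only if there exist an integer `m` and `μ₀ ∈ P∨` such
that `μ = m • μ₀` and `μ₀` is either minuscule or cominuscule. -/
theorem statement1 {V : Type*} [AddCommGroup V] [Module ℚ V] [FiniteDimensional ℚ V]
    (Φ : Set V) (co : V → Module.Dual ℚ V)
    (hRS : QC.IsRootSystem Φ co) (hirr : QC.IsIrreducible Φ co)
    (hspan : Submodule.span ℚ Φ = ⊤)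
    (μ : Module.Dual ℚ V) (hμ : μ ∈ QC.coweightLattice Φ) :
    QC.IsQuasiConstantCowt Φ co μ ↔
      ∃ (m : ℤ) (μ₀ : Module.Dual ℚ V), μ₀ ∈ QC.coweightLattice Φ ∧ μ = (m : ℚ) • μ₀ ∧
        (QC.IsMinusculeCowt Φ μ₀ ∨ QC.IsCominusculeCowt Φ co μ₀) := by
  constructor
  · intro h
    by_cases hμ₀ : μ = 0
    · exact ⟨0, 0, fun α _ ↦ ⟨0, by simp⟩, by simp [hμ₀], .inl fun α _ ↦ by simp⟩
    let P := hRS.rootPairing hspan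
    have : Finite Φ := hRS.finite
    have : Nonempty Φ := hirr.1.to_subtype
    have : P.IsRootSystem := hRS.isRootSystem_rootPairing hspan
    have : P.IsReduced := hRS.isReduced_rootPairing hspan
    have : P.IsIrreducible := hRS.isIrreducible_rootPairing hspan hirr
    classical
    obtain ⟨m, hm, hμm⟩ := P.exists_int_of_quasiConstant hμ₀ (fun α ↦ hμ α α.2)
      fun α hα w hw ↦ h α α.2 hα w <| by
        rwa [hRS.weylGroup_eq_closure_range_reflection hspan]
    have hm' : (m : ℚ) ≠ 0 := mod_cast hm
    obtain ⟨μ, rfl⟩ : ∃ μ₀, μ = (m : ℚ) • μ₀ := ⟨(m : ℚ)⁻¹ • μ, by rw [smul_inv_smul₀ hm']⟩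
    suffices μ ∈ QC.coweightLattice Φ ∧ (QC.IsMinusculeCowt Φ μ ∨ QC.IsCominusculeCowt Φ co μ) from
      ⟨m, μ, this.1, rfl, this.2⟩
    rcases hμm with hμm | ⟨b, i, hi, hμi, χ, hχi, hχ⟩
    · have hmin : QC.IsMinusculeCowt Φ μ := fun α hα ↦ by
        have h := hμm ⟨α, hα⟩
        change m * μ α = 0 ∨ m * μ α = m ∨ m * μ α = -m at h
        rw [mul_eq_zero_iff_left hm', mul_eq_left₀ hm', ← mul_neg_one, mul_right_inj' hm'] at h
        simp only [Set.mem_insert_iff, Set.mem_singleton_iff]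
        tauto
      exact ⟨hmin.mem_coweightLattice, .inl hmin⟩
    · have hμi' (j) (hj : j ∈ b.support) : μ (P.root j) = if j = i then 1 else 0 := by
        apply mul_left_cancel₀ hm'
        simpa using hμi j hj
      refine ⟨fun α hα ↦ ?_, .inr ⟨_, hRS.isBase_image_support hspan b, i, ⟨i, hi, rfl⟩, ?_, ?_⟩⟩
      · obtain ⟨f, -, -, hf⟩ := b.exists_root_eq_sum_int ⟨α, hα⟩
        refine ⟨f i, ?_⟩
        change μ (P.root ⟨α, hα⟩) = _
        rw [hf, map_sum, Finset.sum_eq_single_of_mem i hi fun j hj hji ↦ by simp [hμi' j hj, hji]]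
        simp [hμi' i hi]
      · rintro _ ⟨j, hj, rfl⟩
        simpa [P, Subtype.ext_iff] using hμi' j hj
      · intro η hη α hα
        have h : P.coroot' ⟨α, hα⟩ η = P.coroot' ⟨α, hα⟩ χ :=
          b.coroot'_eq_of_forall_mem_support (fun j hj ↦ by
            rw [hχi j hj, hRS.rootPairing_coroot' hspan]
            simpa [Subtype.ext_iff] using hη j ⟨j, hj, rfl⟩) _
        exact h ▸ hχ ⟨α, hα⟩
  · rintro ⟨m, μ₀, -, rfl, h | h⟩
    · exact (h.isQuasiConstantCowt hRS).smul m
    · exact (h.isQuasiConstantCowt hRS hspan).smul m
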